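/- Let n, m ≥ 1, α ∈ (0,1), β ≥ 0, set Q = (n + m(β+1−α))/(1−α) and q = Q/(Q−1). There exists a constant C > 0 such that for every f ∈ C_c^∞(ℝ^{n+m}) and every λ > 0, λ^{Q/(Q−1)} · |{ξ ∈ ℝ^{n+m} : |f(ξ)| ≥ λ}| ≤ C (∫_{ℝ^{n+m}} |∇_L f(ξ)| dξ) · ‖f‖_{L^q(ℝ^{n+m})}^{1/(Q−1)}, where |·| denotes Lebesgue measure. -/

import Mathlib

open MeasureTheory

/-- The pointwise norm of the Grushin gradient
`∇_L f = (|x|^α ∇_x f, |x|^β ∇_y f)` of `f : ℝⁿ × ℝᵐ → ℝ`,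
i.e. `|∇_L f(x,y)|² = |x|^{2α} |∇_x f|² + |x|^{2β} |∇_y f|²`. -/
noncomputable def gradLNorm (n m : ℕ) (α β : ℝ)
    (f : EuclideanSpace ℝ (Fin n) × EuclideanSpace ℝ (Fin m) → ℝ)
    (ξ : EuclideanSpace ℝ (Fin n) × EuclideanSpace ℝ (Fin m)) : ℝ :=
  Real.sqrt (‖ξ.1‖ ^ (2 * α) * ‖gradient (fun x => f (x, ξ.2)) ξ.1‖ ^ 2
    + ‖ξ.1‖ ^ (2 * β) * ‖gradient (fun y => f (ξ.1, y)) ξ.2‖ ^ 2)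

/-- The homogeneous dimension `Q = (n + m(β+1−α))/(1−α)`. -/
noncomputable def homDim (n m : ℕ) (α β : ℝ) : ℝ :=
  (n + m * (β + 1 - α)) / (1 - α)

open Set

section SignedShift

variable {E : Type*} [NormedAddCommGroup E] [NormedSpace ℝ E]

/-- The translation by `w` on the half space `0 ≤ ℓ` and by `-w` on its complement. -/
noncomputable def signedShift (ℓ : E →L[ℝ] ℝ) (w ξ : E) : E :=
  ξ + (if 0 ≤ ℓ ξ then (1 : ℝ) else -1) • w

lemma enorm_add_sub_le_lintegral_fderiv {f : E → ℝ} (hf : ContDiff ℝ 1 f) (ξ w : E) :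
    ‖f (ξ + w) - f ξ‖ₑ ≤ ∫⁻ τ in Ioc (0 : ℝ) 1, ‖fderiv ℝ f (ξ + τ • w) w‖ₑ := by
  have hd : ∀ τ : ℝ, HasDerivAt (fun τ : ℝ => f (ξ + τ • w)) (fderiv ℝ f (ξ + τ • w) w) τ := by
    intro τ
    have h1 : HasDerivAt (fun τ : ℝ => ξ + τ • w) w τ := by
      simpa using ((hasDerivAt_id τ).smul_const w).const_add ξ
    exact ((hf.differentiable one_ne_zero _).hasFDerivAt).comp_hasDerivAt τ h1
  have hc : Continuous fun τ : ℝ => fderiv ℝ f (ξ + τ • w) w :=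
    ((hf.continuous_fderiv one_ne_zero).comp (by fun_prop)).clm_apply continuous_const
  have h := intervalIntegral.integral_eq_sub_of_hasDerivAt (fun τ _ => hd τ)
    (hc.intervalIntegrable 0 1)
  simp only [one_smul, zero_smul, add_zero] at h
  rw [← h, intervalIntegral.integral_of_le zero_le_one]
  exact MeasureTheory.enorm_integral_le_lintegral_enorm _

variable [MeasurableSpace E] [BorelSpace E]

lemma measurable_signedShift [SecondCountableTopology E] (ℓ : E →L[ℝ] ℝ) :
    Measurable fun p : E × E => signedShift ℓ p.1 p.2 := by
  unfold signedShift
  have h : Measurable fun p : E × E => if 0 ≤ ℓ p.2 then (1 : ℝ) else -1 :=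
    Measurable.ite (measurableSet_le measurable_const (ℓ.measurable.comp measurable_snd))
      measurable_const measurable_const
  exact measurable_snd.add (h.smul measurable_fst)

/-- Moving away from the hyperplane `ℓ = 0` by `w` is injective and misses the slab
`|ℓ| < ℓ w`. -/
lemma lintegral_comp_signedShift_le (μ : Measure E) [μ.IsAddLeftInvariant]
    (ℓ : E →L[ℝ] ℝ) {w : E} (hw : 0 ≤ ℓ w) {g : E → ENNReal} (hg : Measurable g) :
    ∫⁻ ξ, g (signedShift ℓ w ξ) ∂μ ≤ ∫⁻ ξ in {ξ | ℓ w ≤ |ℓ ξ|}, g ξ ∂μ := by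
  have hP : MeasurableSet {ξ | ℓ w ≤ ℓ ξ} := measurableSet_le measurable_const ℓ.measurable
  have hN : MeasurableSet {ξ | ℓ ξ < -ℓ w} := measurableSet_lt ℓ.measurable measurable_const
  have hA : MeasurableSet {ξ | ℓ w ≤ |ℓ ξ|} :=
    measurableSet_le measurable_const (ℓ.continuous.abs.measurable)
  calc ∫⁻ ξ, g (signedShift ℓ w ξ) ∂μ
      ≤ ∫⁻ ξ, ({ξ | ℓ w ≤ ℓ ξ}.indicator g (w + ξ)
          + {ξ | ℓ ξ < -ℓ w}.indicator g (-w + ξ)) ∂μ := by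
        refine lintegral_mono fun ξ => ?_
        by_cases h : 0 ≤ ℓ ξ
        · have : w + ξ ∈ {ξ | ℓ w ≤ ℓ ξ} := by simpa using h
          simp only [signedShift, if_pos h, one_smul]
          rw [indicator_of_mem this, add_comm w ξ]
          exact le_self_add
        · have : -w + ξ ∈ {ξ | ℓ ξ < -ℓ w} := by
            simp only [mem_ofPred_eq, map_add, map_neg]; linarith
          simp only [signedShift, if_neg h, neg_smul, one_smul]
          rw [indicator_of_mem this, add_comm (-w) ξ]
          exact le_add_self
    _ = ∫⁻ ξ, ({ξ | ℓ w ≤ ℓ ξ}.indicator g ξ + {ξ | ℓ ξ < -ℓ w}.indicator g ξ) ∂μ := by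
        rw [lintegral_add_left (f := fun ξ => {ξ | ℓ w ≤ ℓ ξ}.indicator g (w + ξ))
            ((hg.indicator hP).comp (measurable_const_add w)),
          lintegral_add_left_eq_self ({ξ | ℓ w ≤ ℓ ξ}.indicator g) w,
          lintegral_add_left_eq_self ({ξ | ℓ ξ < -ℓ w}.indicator g) (-w),
          lintegral_add_left (hg.indicator hP)]
    _ ≤ ∫⁻ ξ, {ξ | ℓ w ≤ |ℓ ξ|}.indicator g ξ ∂μ := by
        refine lintegral_mono fun ξ => ?_
        by_cases h1 : ℓ w ≤ ℓ ξ
        · have h2 : ¬ ℓ ξ < -ℓ w := by linarith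
          have h3 : ℓ w ≤ |ℓ ξ| := h1.trans (le_abs_self _)
          simp [indicator, h1, h2, h3]
        · by_cases h2 : ℓ ξ < -ℓ w
          · have h3 : ℓ w ≤ |ℓ ξ| := by linarith [neg_le_abs (ℓ ξ)]
            simp [indicator, h1, h2, h3]
          · simp [indicator, h1, h2]
    _ = _ := lintegral_indicator hA _

lemma lintegral_signedShift_add_sub_le [SecondCountableTopology E] (μ : Measure E) [SFinite μ]
    [μ.IsAddLeftInvariant] (ℓ : E →L[ℝ] ℝ) {f : E → ℝ} (hf : ContDiff ℝ 1 f) {w w' : E}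
    (hw : 0 ≤ ℓ w) (hw' : 0 ≤ ℓ w') :
    ∫⁻ ξ, ‖f (signedShift ℓ (w + w') ξ) - f (signedShift ℓ w ξ)‖ₑ ∂μ ≤
      ∫⁻ τ in Ioc (0 : ℝ) 1, ∫⁻ ξ in {ξ | ℓ w + τ * ℓ w' ≤ |ℓ ξ|}, ‖fderiv ℝ f ξ w'‖ₑ ∂μ := by
  have hg : Measurable fun ξ => ‖fderiv ℝ f ξ w'‖ₑ :=
    ((hf.continuous_fderiv one_ne_zero).clm_apply continuous_const).measurable.enorm
  calc ∫⁻ ξ, ‖f (signedShift ℓ (w + w') ξ) - f (signedShift ℓ w ξ)‖ₑ ∂μ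
      ≤ ∫⁻ ξ, (∫⁻ τ in Ioc (0 : ℝ) 1,
          ‖fderiv ℝ f (signedShift ℓ (w + τ • w') ξ) w'‖ₑ) ∂μ := by
        refine lintegral_mono fun ξ => ?_
        have h := enorm_add_sub_le_lintegral_fderiv hf (signedShift ℓ w ξ)
          ((if 0 ≤ ℓ ξ then (1 : ℝ) else -1) • w')
        unfold signedShift at h ⊢
        rw [smul_add, ← add_assoc]
        refine h.trans_eq (lintegral_congr fun τ => ?_)
        rw [smul_add, ← add_assoc, smul_comm τ]
        split_ifs <;> simp
    _ = ∫⁻ τ in Ioc (0 : ℝ) 1, ∫⁻ ξ,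
          ‖fderiv ℝ f (signedShift ℓ (w + τ • w') ξ) w'‖ₑ ∂μ := by
        refine lintegral_lintegral_swap (Measurable.aemeasurable ?_)
        have h : Measurable fun p : E × ℝ => signedShift ℓ (w + p.2 • w') p.1 :=
          (measurable_signedShift ℓ).comp (g := fun p : E × E => signedShift ℓ p.1 p.2)
            (f := fun p : E × ℝ => (w + p.2 • w', p.1)) (by fun_prop)
        exact hg.comp h
    _ ≤ _ := by
        refine setLIntegral_mono' measurableSet_Ioc fun τ hτ => ?_
        have h0 : 0 ≤ ℓ (w + τ • w') := by
          simpa using add_nonneg hw (mul_nonneg hτ.1.le hw')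
        refine (lintegral_comp_signedShift_le μ ℓ h0 hg).trans_eq ?_
        simp


lemma measure_preimage_signedShift (μ : Measure E) [μ.IsAddLeftInvariant] [μ.IsNegInvariant]
    (ℓ : E →L[ℝ] ℝ) (ξ : E) {A : Set E} (hA : MeasurableSet A) :
    μ {w | signedShift ℓ w ξ ∈ A} = μ A := by
  by_cases h : 0 ≤ ℓ ξ
  · simp only [signedShift, if_pos h, one_smul]
    exact (measurePreserving_add_left μ ξ).measure_preimage hA.nullMeasurableSet
  · simp only [signedShift, if_neg h, neg_smul, one_smul, ← sub_eq_add_neg]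
    exact (Measure.measurePreserving_sub_left μ ξ).measure_preimage hA.nullMeasurableSet

/-- If `f` is `L¹`-close to its shifts by `w ∈ W`, and `W` is large compared with the set where
`|f|` is at least `lam / 2`, then the set where `|f|` is at least `lam` is small. -/
lemma mul_measure_superlevel_le [SecondCountableTopology E] (μ : Measure E) [SFinite μ]
    [μ.IsAddLeftInvariant] [μ.IsNegInvariant] (ℓ : E →L[ℝ] ℝ) {f : E → ℝ} (hf : Measurable f)
    {W : Set E} (hW : MeasurableSet W) (hW0 : μ W ≠ 0) (hW1 : μ W ≠ ⊤) {lam : ℝ} (hl : 0 < lam)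
    (hV : 2 * μ {z | lam / 2 ≤ |f z|} ≤ μ W) {B : ENNReal}
    (hB : ∀ w ∈ W, ∫⁻ ξ, ‖f (signedShift ℓ w ξ) - f ξ‖ₑ ∂μ ≤ B) :
    ENNReal.ofReal (lam / 4) * μ {z | lam ≤ |f z|} ≤ B := by
  have hF : Measurable fun p : E × E => ‖f (signedShift ℓ p.2 p.1) - f p.1‖ₑ :=
    ((hf.comp ((measurable_signedShift ℓ).comp measurable_swap)).sub
      (hf.comp measurable_fst)).enorm
  have hS : ∀ c : ℝ, MeasurableSet {z | c ≤ |f z|} := fun c =>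
    measurableSet_le measurable_const (continuous_abs.measurable.comp hf)
  have hhalf : ENNReal.ofReal (lam / 2) = ENNReal.ofReal (lam / 4) + ENNReal.ofReal (lam / 4) := by
    rw [← ENNReal.ofReal_add (by positivity) (by positivity)]; congr 1; ring
  have pointwise : ∀ ξ ∈ {z | lam ≤ |f z|}, ENNReal.ofReal (lam / 4) * μ W ≤
      ∫⁻ w in W, ‖f (signedShift ℓ w ξ) - f ξ‖ₑ ∂μ := by
    intro ξ hξ
    have hbad : MeasurableSet {w | signedShift ℓ w ξ ∈ {z | lam / 2 ≤ |f z|}} :=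
      ((measurable_signedShift ℓ).comp (measurable_id.prodMk measurable_const)) (hS (lam / 2))
    have h1 : ENNReal.ofReal (lam / 2) * μ W ≤
        ∫⁻ w in W, ‖f (signedShift ℓ w ξ) - f ξ‖ₑ ∂μ +
          ENNReal.ofReal (lam / 2) * μ {z | lam / 2 ≤ |f z|} :=
      calc _ = ∫⁻ _ in W, ENNReal.ofReal (lam / 2) ∂μ := by rw [setLIntegral_const]
        _ ≤ ∫⁻ w in W, (‖f (signedShift ℓ w ξ) - f ξ‖ₑ +
              {w | signedShift ℓ w ξ ∈ {z | lam / 2 ≤ |f z|}}.indicator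
                (fun _ => ENNReal.ofReal (lam / 2)) w) ∂μ := by
            refine lintegral_mono fun w => ?_
            by_cases hw : lam / 2 ≤ |f (signedShift ℓ w ξ)|
            · rw [indicator_of_mem (by exact hw)]
              exact le_add_self
            · refine le_add_right ?_
              rw [Real.enorm_eq_ofReal_abs]
              refine ENNReal.ofReal_le_ofReal ?_
              have h2 : lam ≤ |f ξ| := hξ
              have h3 := abs_sub_abs_le_abs_sub (f ξ) (f (signedShift ℓ w ξ))
              rw [abs_sub_comm] at h3
              linarith
        _ = ∫⁻ w in W, ‖f (signedShift ℓ w ξ) - f ξ‖ₑ ∂μ + ∫⁻ w in W,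
              {w | signedShift ℓ w ξ ∈ {z | lam / 2 ≤ |f z|}}.indicator
                (fun _ => ENNReal.ofReal (lam / 2)) w ∂μ :=
            lintegral_add_right _ (measurable_const.indicator hbad)
        _ ≤ _ := by
            gcongr
            refine (setLIntegral_le_lintegral _ _).trans_eq ?_
            rw [lintegral_indicator_const hbad, measure_preimage_signedShift μ ℓ ξ (hS _)]
    have h4 : ENNReal.ofReal (lam / 2) * μ {z | lam / 2 ≤ |f z|} ≤
        ENNReal.ofReal (lam / 4) * μ W := by
      refine le_trans (le_of_eq ?_) (mul_le_mul_right hV _)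
      rw [hhalf]; ring
    have h5 := h1.trans (add_le_add_right h4 _)
    rw [hhalf, add_mul] at h5
    exact (ENNReal.add_le_add_iff_right (ENNReal.mul_ne_top ENNReal.ofReal_ne_top hW1)).1 h5
  refine (ENNReal.mul_le_mul_iff_left hW0 hW1).1 ?_
  calc ENNReal.ofReal (lam / 4) * μ {z | lam ≤ |f z|} * μ W
      = ∫⁻ _ in {z | lam ≤ |f z|}, ENNReal.ofReal (lam / 4) * μ W ∂μ := by
        rw [setLIntegral_const]; ring
    _ ≤ ∫⁻ ξ in {z | lam ≤ |f z|}, ∫⁻ w in W, ‖f (signedShift ℓ w ξ) - f ξ‖ₑ ∂μ ∂μ :=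
        setLIntegral_mono' (hS lam) pointwise
    _ ≤ ∫⁻ ξ, ∫⁻ w in W, ‖f (signedShift ℓ w ξ) - f ξ‖ₑ ∂μ ∂μ := setLIntegral_le_lintegral _ _
    _ = ∫⁻ w in W, ∫⁻ ξ, ‖f (signedShift ℓ w ξ) - f ξ‖ₑ ∂μ ∂μ :=
        lintegral_lintegral_swap hF.aemeasurable
    _ ≤ ∫⁻ _ in W, B ∂μ := setLIntegral_mono' hW hB
    _ = B * μ W := setLIntegral_const _ _

end SignedShift

section Grushin

variable {n m : ℕ} {α β : ℝ}
  {f : EuclideanSpace ℝ (Fin n) × EuclideanSpace ℝ (Fin m) → ℝ}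

instance isAddHaarMeasure_volume_euclidean_prod :
    (volume : Measure (EuclideanSpace ℝ (Fin n) × EuclideanSpace ℝ (Fin m))).IsAddHaarMeasure :=
  Measure.prod.instIsAddHaarMeasure _ _

instance isNegInvariant_volume_euclidean_prod :
    (volume : Measure (EuclideanSpace ℝ (Fin n) × EuclideanSpace ℝ (Fin m))).IsNegInvariant :=
  Measure.IsAddHaarMeasure.isNegInvariant_of_regular _

lemma norm_gradient_eq_norm_fderiv {F : Type*} [NormedAddCommGroup F] [InnerProductSpace ℝ F]
    [CompleteSpace F] (g : F → ℝ) (x : F) : ‖gradient g x‖ = ‖fderiv ℝ g x‖ := by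
  simp [gradient]

lemma fderiv_partial_left (hf : Differentiable ℝ f)
    (ξ : EuclideanSpace ℝ (Fin n) × EuclideanSpace ℝ (Fin m)) :
    fderiv ℝ (fun x => f (x, ξ.2)) ξ.1 =
      (fderiv ℝ f ξ).comp (ContinuousLinearMap.inl ℝ _ _) :=
  ((hf ξ).hasFDerivAt.comp ξ.1 (hasFDerivAt_prodMk_left ξ.1 ξ.2)).fderiv

lemma fderiv_partial_right (hf : Differentiable ℝ f)
    (ξ : EuclideanSpace ℝ (Fin n) × EuclideanSpace ℝ (Fin m)) :
    fderiv ℝ (fun y => f (ξ.1, y)) ξ.2 =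
      (fderiv ℝ f ξ).comp (ContinuousLinearMap.inr ℝ _ _) :=
  ((hf ξ).hasFDerivAt.comp ξ.2 (hasFDerivAt_prodMk_right ξ.1 ξ.2)).fderiv

lemma gradLNorm_nonneg (ξ : EuclideanSpace ℝ (Fin n) × EuclideanSpace ℝ (Fin m)) :
    0 ≤ gradLNorm n m α β f ξ := Real.sqrt_nonneg _

lemma norm_fst_rpow_mul_abs_fderiv_le (hf : Differentiable ℝ f)
    (ξ : EuclideanSpace ℝ (Fin n) × EuclideanSpace ℝ (Fin m)) (h : EuclideanSpace ℝ (Fin n)) :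
    ‖ξ.1‖ ^ α * |fderiv ℝ f ξ (h, 0)| ≤ ‖h‖ * gradLNorm n m α β f ξ := by
  have h1 : |fderiv ℝ f ξ (h, 0)| ≤ ‖gradient (fun x => f (x, ξ.2)) ξ.1‖ * ‖h‖ := by
    rw [norm_gradient_eq_norm_fderiv, fderiv_partial_left hf]
    exact ((fderiv ℝ f ξ).comp (ContinuousLinearMap.inl ℝ _ _)).le_opNorm h
  have h2 : ‖ξ.1‖ ^ α * ‖gradient (fun x => f (x, ξ.2)) ξ.1‖ ≤ gradLNorm n m α β f ξ := by
    refine Real.le_sqrt_of_sq_le ?_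
    rw [mul_pow, ← Real.rpow_mul_natCast (norm_nonneg _), mul_comm α]
    exact le_add_of_nonneg_right (by positivity)
  calc _ ≤ ‖ξ.1‖ ^ α * (‖gradient (fun x => f (x, ξ.2)) ξ.1‖ * ‖h‖) := by gcongr
    _ = ‖h‖ * (‖ξ.1‖ ^ α * ‖gradient (fun x => f (x, ξ.2)) ξ.1‖) := by ring
    _ ≤ _ := by gcongr

lemma norm_fst_rpow_mul_abs_fderiv_right_le (hf : Differentiable ℝ f)
    (ξ : EuclideanSpace ℝ (Fin n) × EuclideanSpace ℝ (Fin m)) (v : EuclideanSpace ℝ (Fin m)) :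
    ‖ξ.1‖ ^ β * |fderiv ℝ f ξ (0, v)| ≤ ‖v‖ * gradLNorm n m α β f ξ := by
  have h1 : |fderiv ℝ f ξ (0, v)| ≤ ‖gradient (fun y => f (ξ.1, y)) ξ.2‖ * ‖v‖ := by
    rw [norm_gradient_eq_norm_fderiv, fderiv_partial_right hf]
    exact ((fderiv ℝ f ξ).comp (ContinuousLinearMap.inr ℝ _ _)).le_opNorm v
  have h2 : ‖ξ.1‖ ^ β * ‖gradient (fun y => f (ξ.1, y)) ξ.2‖ ≤ gradLNorm n m α β f ξ := by
    refine Real.le_sqrt_of_sq_le ?_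
    rw [mul_pow, ← Real.rpow_mul_natCast (norm_nonneg _), mul_comm β]
    exact le_add_of_nonneg_left (by positivity)
  calc _ ≤ ‖ξ.1‖ ^ β * (‖gradient (fun y => f (ξ.1, y)) ξ.2‖ * ‖v‖) := by gcongr
    _ = ‖v‖ * (‖ξ.1‖ ^ β * ‖gradient (fun y => f (ξ.1, y)) ξ.2‖) := by ring
    _ ≤ _ := by gcongr

lemma continuous_gradLNorm (hα : 0 < α) (hβ : 0 ≤ β) (hf : ContDiff ℝ 1 f) :
    Continuous (gradLNorm n m α β f) := by
  have hd := hf.differentiable one_ne_zero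
  have hc := hf.continuous_fderiv one_ne_zero
  unfold gradLNorm
  simp only [norm_gradient_eq_norm_fderiv, fderiv_partial_left hd, fderiv_partial_right hd]
  refine Real.continuous_sqrt.comp (.add (.mul ?_ ?_) (.mul ?_ ?_))
  · exact continuous_fst.norm.rpow_const fun _ => Or.inr (by positivity)
  · exact (hc.clm_comp continuous_const).norm.pow 2
  · exact continuous_fst.norm.rpow_const fun _ => Or.inr (by positivity)
  · exact (hc.clm_comp continuous_const).norm.pow 2

lemma integrable_gradLNorm (hα : 0 < α) (hβ : 0 ≤ β) (hf : ContDiff ℝ 1 f)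
    (hs : HasCompactSupport f) : Integrable (gradLNorm n m α β f) := by
  have hd := hf.differentiable one_ne_zero
  refine (continuous_gradLNorm hα hβ hf).integrable_of_hasCompactSupport
    ((hs.fderiv ℝ).mono fun ξ hξ h0 => hξ ?_)
  unfold gradLNorm
  simp [norm_gradient_eq_norm_fderiv, fderiv_partial_left hd, fderiv_partial_right hd, h0]

/-- The coordinate `x_i` as a continuous linear functional on `ℝⁿ × ℝᵐ`. -/
noncomputable def fstCoord (m : ℕ) (i : Fin n) :
    EuclideanSpace ℝ (Fin n) × EuclideanSpace ℝ (Fin m) →L[ℝ] ℝ :=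
  (EuclideanSpace.proj i).comp (ContinuousLinearMap.fst ℝ _ _)

@[simp]
lemma fstCoord_apply (i : Fin n) (ξ : EuclideanSpace ℝ (Fin n) × EuclideanSpace ℝ (Fin m)) :
    fstCoord m i ξ = ξ.1 i := rfl

lemma lintegral_Ioc_rpow_neg (hα : α < 1) :
    ∫⁻ τ in Ioc (0 : ℝ) 1, ENNReal.ofReal (τ ^ (-α)) = ENNReal.ofReal (1 / (1 - α)) := by
  have hi : IntervalIntegrable (fun τ : ℝ => τ ^ (-α)) volume 0 1 :=
    intervalIntegral.intervalIntegrable_rpow' (by linarith)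
  rw [← ofReal_integral_eq_lintegral_ofReal
    ((intervalIntegrable_iff_integrableOn_Ioc_of_le zero_le_one).1 hi)]
  · rw [← intervalIntegral.integral_of_le zero_le_one, integral_rpow (Or.inl (by linarith))]
    rw [Real.zero_rpow (by linarith), Real.one_rpow, sub_zero, neg_add_eq_sub]
  · filter_upwards [ae_restrict_mem measurableSet_Ioc] with τ hτ
    exact Real.rpow_nonneg hτ.1.le _

lemma lintegral_shift_fst_le (hα : α ∈ Ioo (0 : ℝ) 1) (hf : ContDiff ℝ 1 f) (i : Fin n)
    {s : ℝ} (hs : 0 < s) {h : EuclideanSpace ℝ (Fin n)} (hh : ‖h‖ ≤ 3 * s) (hi : s ≤ h i) :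
    ∫⁻ ξ, ‖f (signedShift (fstCoord m i) (h, 0) ξ) - f ξ‖ₑ ≤
      ENNReal.ofReal (3 / (1 - α) * s ^ (1 - α)) *
        ∫⁻ ξ, ENNReal.ofReal (gradLNorm n m α β f ξ) := by
  set I := ∫⁻ ξ, ENNReal.ofReal (gradLNorm n m α β f ξ) with hI
  have hd := hf.differentiable one_ne_zero
  have key := lintegral_signedShift_add_sub_le volume (fstCoord m i) hf (w := 0) (w' := (h, 0))
    (by simp) (by simpa using hs.le.trans hi)
  have hz : ∀ ξ, signedShift (fstCoord m i) 0 ξ = ξ := fun ξ => by simp [signedShift]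
  simp only [hz, zero_add, map_zero] at key
  refine key.trans ?_
  calc _ ≤ ∫⁻ τ in Ioc (0 : ℝ) 1, ENNReal.ofReal (τ ^ (-α)) *
          (ENNReal.ofReal (3 * s ^ (1 - α)) * I) := by
        refine setLIntegral_mono' measurableSet_Ioc fun τ hτ => ?_
        rw [← mul_assoc, ← ENNReal.ofReal_mul (Real.rpow_nonneg hτ.1.le _), hI,
          ← lintegral_const_mul' _ _ ENNReal.ofReal_ne_top]
        refine le_trans (setLIntegral_mono_ae' ?_ (.of_forall fun ξ hξ => ?_))
          (setLIntegral_le_lintegral _ _)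
        · exact measurableSet_le measurable_const (fstCoord m i).continuous.abs.measurable
        · rw [← ENNReal.ofReal_mul (by have := hτ.1; positivity), Real.enorm_eq_ofReal_abs]
          refine ENNReal.ofReal_le_ofReal ?_
          have hτs : 0 < τ * s := mul_pos hτ.1 hs
          have hx : τ * s ≤ ‖ξ.1‖ := by
            have h1 : τ * h i ≤ |ξ.1 i| := hξ
            have h2 : |ξ.1 i| ≤ ‖ξ.1‖ := PiLp.norm_apply_le ξ.1 i
            exact (mul_le_mul_of_nonneg_left hi hτ.1.le).trans (h1.trans h2)
          have h3 : (τ * s) ^ α * |fderiv ℝ f ξ (h, 0)| ≤ 3 * s * gradLNorm n m α β f ξ :=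
            calc _ ≤ ‖ξ.1‖ ^ α * |fderiv ℝ f ξ (h, 0)| := by
                  gcongr; exact hα.1.le
              _ ≤ ‖h‖ * gradLNorm n m α β f ξ := norm_fst_rpow_mul_abs_fderiv_le hd ξ h
              _ ≤ _ := mul_le_mul_of_nonneg_right hh (gradLNorm_nonneg ξ)
          calc _ = τ ^ (-α) * s ^ (-α) * ((τ * s) ^ α * |fderiv ℝ f ξ (h, 0)|) := by
                rw [Real.mul_rpow hτ.1.le hs.le, Real.rpow_neg hτ.1.le, Real.rpow_neg hs.le]
                have := (Real.rpow_pos_of_pos hτ.1 α).ne'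
                have := (Real.rpow_pos_of_pos hs α).ne'
                field_simp
            _ ≤ τ ^ (-α) * s ^ (-α) * (3 * s * gradLNorm n m α β f ξ) :=
                mul_le_mul_of_nonneg_left h3 (by have := hτ.1; positivity)
            _ = _ := by
                rw [sub_eq_neg_add, Real.rpow_add_one hs.ne']; ring
    _ = _ := by
        rw [lintegral_mul_const _ (by fun_prop),
          lintegral_Ioc_rpow_neg hα.2, ← mul_assoc, ← ENNReal.ofReal_mul]
        · congr 2; ring
        · exact (one_div_pos.2 (sub_pos.2 hα.2)).le

lemma lintegral_shift_snd_le (hβ : 0 ≤ β) (hf : ContDiff ℝ 1 f) (i : Fin n)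
    {s : ℝ} (hs : 0 < s) {h : EuclideanSpace ℝ (Fin n)} (hi : s ≤ h i)
    {v : EuclideanSpace ℝ (Fin m)} (hv : ‖v‖ ≤ s ^ (1 - α + β)) :
    ∫⁻ ξ, ‖f (signedShift (fstCoord m i) (h, v) ξ) - f (signedShift (fstCoord m i) (h, 0) ξ)‖ₑ ≤
      ENNReal.ofReal (s ^ (1 - α)) * ∫⁻ ξ, ENNReal.ofReal (gradLNorm n m α β f ξ) := by
  have hd := hf.differentiable one_ne_zero
  have key := lintegral_signedShift_add_sub_le volume (fstCoord m i) hf (w := (h, 0))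
    (w' := (0, v)) (by simpa using hs.le.trans hi) (by simp)
  simp only [Prod.mk_add_mk, add_zero, zero_add, fstCoord_apply, PiLp.zero_apply, mul_zero] at key
  refine key.trans ?_
  rw [setLIntegral_const, Real.volume_Ioc, sub_zero, ENNReal.ofReal_one, mul_one,
    ← lintegral_const_mul' _ _ ENNReal.ofReal_ne_top]
  refine le_trans (setLIntegral_mono_ae' ?_ (.of_forall fun ξ hξ => ?_))
    (setLIntegral_le_lintegral _ _)
  · exact measurableSet_le measurable_const (fstCoord m i).continuous.abs.measurable
  · rw [← ENNReal.ofReal_mul (by positivity), Real.enorm_eq_ofReal_abs]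
    refine ENNReal.ofReal_le_ofReal ?_
    have hx : s ≤ ‖ξ.1‖ := hi.trans (le_trans hξ (PiLp.norm_apply_le ξ.1 i))
    have h3 : s ^ β * |fderiv ℝ f ξ (0, v)| ≤ s ^ β * (s ^ (1 - α) * gradLNorm n m α β f ξ) :=
      calc _ ≤ ‖ξ.1‖ ^ β * |fderiv ℝ f ξ (0, v)| := by gcongr
        _ ≤ ‖v‖ * gradLNorm n m α β f ξ := norm_fst_rpow_mul_abs_fderiv_right_le hd ξ v
        _ ≤ s ^ (1 - α + β) * gradLNorm n m α β f ξ :=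
            mul_le_mul_of_nonneg_right hv (gradLNorm_nonneg ξ)
        _ = _ := by rw [Real.rpow_add hs]; ring
    exact le_of_mul_le_mul_left h3 (Real.rpow_pos_of_pos hs β)


lemma lintegral_shift_le (hα : α ∈ Ioo (0 : ℝ) 1) (hβ : 0 ≤ β) (hf : ContDiff ℝ 1 f) (i : Fin n)
    {s : ℝ} (hs : 0 < s) {w : EuclideanSpace ℝ (Fin n) × EuclideanSpace ℝ (Fin m)}
    (hw : w ∈ Metric.ball (EuclideanSpace.single i (2 * s)) s ×ˢ
      Metric.ball 0 (s ^ (1 - α + β))) :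
    ∫⁻ ξ, ‖f (signedShift (fstCoord m i) w ξ) - f ξ‖ₑ ≤
      ENNReal.ofReal ((3 / (1 - α) + 1) * s ^ (1 - α)) *
        ∫⁻ ξ, ENNReal.ofReal (gradLNorm n m α β f ξ) := by
  obtain ⟨h, v⟩ := w
  obtain ⟨hh, hv⟩ := hw
  simp only [Metric.mem_ball, dist_eq_norm, sub_zero] at hh hv
  have hh3 : ‖h‖ ≤ 3 * s := by
    have h1 := norm_le_norm_add_norm_sub' h (EuclideanSpace.single i (2 * s))
    rw [PiLp.norm_single, Real.norm_of_nonneg (by positivity)] at h1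
    linarith
  have hi : s ≤ h i := by
    have h1 : |h i - 2 * s| ≤ ‖h - EuclideanSpace.single i (2 * s)‖ := by
      simpa using PiLp.norm_apply_le (h - EuclideanSpace.single i (2 * s)) i
    linarith [neg_le_abs (h i - 2 * s)]
  have hm : Measurable fun ξ => ‖f (signedShift (fstCoord m i) (h, 0) ξ) - f ξ‖ₑ := by
    have h1 : Measurable fun ξ => signedShift (fstCoord m i) (h, 0) ξ :=
      (measurable_signedShift (fstCoord m i)).comp (measurable_const.prodMk measurable_id)
    exact ((hf.continuous.measurable.comp h1).sub hf.continuous.measurable).enorm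
  have h1α : 0 < 1 - α := sub_pos.2 hα.2
  rw [add_mul, one_mul, ENNReal.ofReal_add (by positivity) (by positivity), add_mul]
  calc _ ≤ ∫⁻ ξ, (‖f (signedShift (fstCoord m i) (h, 0) ξ) - f ξ‖ₑ +
        ‖f (signedShift (fstCoord m i) (h, v) ξ)
          - f (signedShift (fstCoord m i) (h, 0) ξ)‖ₑ) := by
        refine lintegral_mono fun ξ => ?_
        rw [add_comm]
        exact (enorm_add_le _ _).trans_eq' (by rw [sub_add_sub_cancel])
    _ ≤ _ := by
        rw [lintegral_add_left hm]
        exact add_le_add (lintegral_shift_fst_le hα hf i hs hh3 hi)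
          (lintegral_shift_snd_le hβ hf i hs hi hv.le)

lemma volume_ball_prod_ball (x : EuclideanSpace ℝ (Fin n)) {s t : ℝ} (hs : 0 < s) (ht : 0 < t) :
    volume (Metric.ball x s ×ˢ Metric.ball (0 : EuclideanSpace ℝ (Fin m)) t) =
      ENNReal.ofReal (volume.real (Metric.ball (0 : EuclideanSpace ℝ (Fin n)) 1) *
        volume.real (Metric.ball (0 : EuclideanSpace ℝ (Fin m)) 1) * (s ^ n * t ^ m)) := by
  rw [Measure.volume_eq_prod, Measure.prod_prod, Measure.addHaar_ball_of_pos _ _ hs,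
    Measure.addHaar_ball_of_pos _ _ ht, finrank_euclideanSpace_fin, finrank_euclideanSpace_fin,
    ENNReal.ofReal_mul (by positivity), ENNReal.ofReal_mul (by positivity),
    ENNReal.ofReal_mul (by positivity), ofReal_measureReal, ofReal_measureReal]
  ring

lemma one_lt_homDim (hn : 1 ≤ n) (hα : α ∈ Ioo (0 : ℝ) 1) (hβ : 0 ≤ β) :
    1 < homDim n m α β := by
  have h1 : (1 : ℝ) ≤ n := by exact_mod_cast hn
  have h2 : 0 ≤ (m : ℝ) * (β + 1 - α) := mul_nonneg m.cast_nonneg (by linarith [hα.2])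
  rw [homDim, one_lt_div (sub_pos.2 hα.2)]
  linarith [hα.1]

lemma volume_superlevel_le (hf : Continuous f) (hs : HasCompactSupport f) {q : ℝ} (hq : 0 < q)
    {lam : ℝ} (hl : 0 < lam) :
    volume {z | lam ≤ |f z|} ≤ ENNReal.ofReal ((∫ ξ, |f ξ| ^ q) / lam ^ q) := by
  have hc : Continuous fun ξ => |f ξ| ^ q := hf.abs.rpow_const fun _ => Or.inr hq.le
  have hi : Integrable fun ξ => |f ξ| ^ q :=
    hc.integrable_of_hasCompactSupport (hs.comp_left (g := fun a => |a| ^ q) (by simp [hq.ne']))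
  have hlq : 0 < lam ^ q := Real.rpow_pos_of_pos hl q
  have h := mul_meas_ge_le_lintegral (μ := volume) hc.measurable.ennreal_ofReal
    (ENNReal.ofReal (lam ^ q))
  rw [← ofReal_integral_eq_lintegral_ofReal hi (.of_forall fun ξ => by positivity)] at h
  rw [ENNReal.ofReal_div_of_pos hlq, ENNReal.le_div_iff_mul_le (by simp [hlq]) (by simp), mul_comm]
  refine le_trans (mul_le_mul_right (measure_mono fun z hz => ?_) _) h
  exact ENNReal.ofReal_le_ofReal (Real.rpow_le_rpow hl.le hz hq.le)

/-- The weak-type bound at a fixed scale `r`, large enough for the box of homogeneous radius `r`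
to have twice the measure allowed by Chebyshev's inequality at level `lam / 2`. -/
lemma mul_volume_superlevel_le (hn : 1 ≤ n) (hα : α ∈ Ioo (0 : ℝ) 1) (hβ : 0 ≤ β)
    (hf : ContDiff ℝ 1 f) (hsupp : HasCompactSupport f) {lam q r : ℝ} (hl : 0 < lam) (hq : 0 < q)
    (hr : 0 < r)
    (hrQ : 2 * ((∫ ξ, |f ξ| ^ q) / (lam / 2) ^ q) ≤
      volume.real (Metric.ball (0 : EuclideanSpace ℝ (Fin n)) 1) *
        volume.real (Metric.ball (0 : EuclideanSpace ℝ (Fin m)) 1) * r ^ homDim n m α β) :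
    lam / 4 * volume.real {z | lam ≤ |f z|} ≤
      (3 / (1 - α) + 1) * r * ∫ ξ, gradLNorm n m α β f ξ := by
  have h1α : 0 < 1 - α := sub_pos.2 hα.2
  set s := r ^ (1 / (1 - α)) with hs_def
  have hs : 0 < s := Real.rpow_pos_of_pos hr _
  have ht : 0 < s ^ (1 - α + β) := Real.rpow_pos_of_pos hs _
  have hsr : s ^ (1 - α) = r := by
    rw [hs_def, ← Real.rpow_mul hr.le, one_div_mul_cancel h1α.ne', Real.rpow_one]
  have hsQ : s ^ n * (s ^ (1 - α + β)) ^ m = r ^ homDim n m α β := by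
    rw [← Real.rpow_natCast, ← Real.rpow_mul_natCast hs.le, ← Real.rpow_add hs, hs_def,
      ← Real.rpow_mul hr.le]
    congr 1
    rw [homDim]; field_simp; ring
  let i : Fin n := ⟨0, hn⟩
  have hvol := volume_ball_prod_ball (m := m) (EuclideanSpace.single i (2 * s)) hs ht
  rw [hsQ] at hvol
  have hI : ∫⁻ ξ, ENNReal.ofReal (gradLNorm n m α β f ξ) =
      ENNReal.ofReal (∫ ξ, gradLNorm n m α β f ξ) :=
    (ofReal_integral_eq_lintegral_ofReal (integrable_gradLNorm hα.1 hβ hf hsupp)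
      (.of_forall gradLNorm_nonneg)).symm
  have key := mul_measure_superlevel_le volume (fstCoord m i) hf.continuous.measurable
    (Metric.isOpen_ball.prod Metric.isOpen_ball).measurableSet
    ((Metric.isOpen_ball.prod Metric.isOpen_ball).measure_ne_zero volume
      ((Metric.nonempty_ball.2 hs).prod (Metric.nonempty_ball.2 ht)))
    (by rw [hvol]; exact ENNReal.ofReal_ne_top) hl ?_
    (fun w hw => lintegral_shift_le hα hβ hf i hs hw)
  · have hfin : volume {z | lam ≤ |f z|} ≠ ⊤ :=
      ((volume_superlevel_le hf.continuous hsupp hq hl).trans_lt ENNReal.ofReal_lt_top).ne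
    rw [hI, ← ofReal_measureReal hfin, ← ENNReal.ofReal_mul (by positivity),
      ← ENNReal.ofReal_mul (by positivity), hsr] at key
    exact (ENNReal.ofReal_le_ofReal_iff
      (mul_nonneg (by positivity) (integral_nonneg gradLNorm_nonneg))).1 key
  · rw [hvol]
    calc _ ≤ 2 * ENNReal.ofReal ((∫ ξ, |f ξ| ^ q) / (lam / 2) ^ q) :=
          mul_le_mul_right (volume_superlevel_le hf.continuous hsupp hq (half_pos hl)) _
      _ = ENNReal.ofReal (2 * ((∫ ξ, |f ξ| ^ q) / (lam / 2) ^ q)) := by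
          rw [ENNReal.ofReal_mul zero_le_two, ENNReal.ofReal_ofNat]
      _ ≤ _ := ENNReal.ofReal_le_ofReal hrQ

end Grushin

/-- The weak-type inequality: for `q = Q/(Q−1)`,
`λ^{Q/(Q−1)} |{|f| ≥ λ}| ≤ C ‖∇_L f‖₁ ‖f‖_q^{1/(Q−1)}`. -/
theorem weak_type_ineq (n m : ℕ) (hn : 1 ≤ n) (hm : 1 ≤ m) (α β : ℝ)
    (hα : α ∈ Set.Ioo (0 : ℝ) 1) (hβ : 0 ≤ β) :
    ∃ C : ℝ, 0 < C ∧
      ∀ f : EuclideanSpace ℝ (Fin n) × EuclideanSpace ℝ (Fin m) → ℝ,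
        ContDiff ℝ (⊤ : ℕ∞) f → HasCompactSupport f →
        ∀ lam : ℝ, 0 < lam →
          lam ^ (homDim n m α β / (homDim n m α β - 1)) *
              (volume {ξ | lam ≤ |f ξ|}).toReal
            ≤ C * (∫ ξ, gradLNorm n m α β f ξ) *
                ((∫ ξ, |f ξ| ^ (homDim n m α β / (homDim n m α β - 1))) ^
                    ((homDim n m α β - 1) / homDim n m α β)) ^
                  (1 / (homDim n m α β - 1)) := by
  set Q := homDim n m α β with hQ_def
  set q := Q / (Q - 1) with hq_def
  have hQ : 1 < Q := one_lt_homDim hn hα hβ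
  have hQ0 : 0 < Q := by linarith
  have hQ1 : 0 < Q - 1 := by linarith
  have hq : 0 < q := div_pos hQ0 hQ1
  have h1α : 0 < 1 - α := sub_pos.2 hα.2
  set c := volume.real (Metric.ball (0 : EuclideanSpace ℝ (Fin n)) 1) *
    volume.real (Metric.ball (0 : EuclideanSpace ℝ (Fin m)) 1) with hc_def
  have hc : 0 < c := mul_pos
    (ENNReal.toReal_pos (Metric.measure_ball_pos _ _ one_pos).ne' measure_ball_lt_top.ne)
    (ENNReal.toReal_pos (Metric.measure_ball_pos _ _ one_pos).ne' measure_ball_lt_top.ne)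
  refine ⟨4 * (3 / (1 - α) + 1) * (2 * 2 ^ q / c) ^ (1 / Q), by positivity, ?_⟩
  intro f hf hs lam hl
  have hf1 : ContDiff ℝ 1 f := hf.of_le (by exact_mod_cast le_top)
  have hN0 : 0 ≤ ∫ ξ, |f ξ| ^ q := integral_nonneg fun ξ => by positivity
  have hI0 : 0 ≤ ∫ ξ, gradLNorm n m α β f ξ := integral_nonneg gradLNorm_nonneg
  set N := ∫ ξ, |f ξ| ^ q with hN_def
  set I := ∫ ξ, gradLNorm n m α β f ξ with hI_def
  rcases hN0.eq_or_lt with hN | hN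
  · have h := volume_superlevel_le hf.continuous hs hq hl
    rw [← hN_def, ← hN, zero_div, ENNReal.ofReal_zero, nonpos_iff_eq_zero] at h
    rw [h, ENNReal.toReal_zero, mul_zero]
    positivity
  have hexp : (N ^ ((Q - 1) / Q)) ^ (1 / (Q - 1)) = N ^ (1 / Q) := by
    rw [← Real.rpow_mul hN.le]
    congr 1
    field_simp
  set r := (2 * 2 ^ q / c) ^ (1 / Q) * (lam ^ (-(q - 1)) * N ^ (1 / Q)) with hr_def
  have hr : 0 < r := by positivity
  have hrQ : 2 * (N / (lam / 2) ^ q) = c * r ^ Q := by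
    have hexp2 : -(q - 1) * Q = -q := by
      rw [hq_def]; field_simp; ring
    rw [hr_def, Real.mul_rpow (by positivity) (by positivity),
      Real.mul_rpow (by positivity) (by positivity), ← Real.rpow_mul (by positivity),
      ← Real.rpow_mul hl.le, ← Real.rpow_mul hN.le, one_div_mul_cancel hQ0.ne', Real.rpow_one,
      Real.rpow_one, hexp2, Real.rpow_neg hl.le, Real.div_rpow hl.le zero_le_two]
    have := (Real.rpow_pos_of_pos hl q).ne'
    field_simp
  have key := mul_volume_superlevel_le hn hα hβ hf1 hs hl hq hr hrQ.le
  rw [hexp]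
  calc lam ^ q * (volume {ξ | lam ≤ |f ξ|}).toReal
      = 4 * lam ^ (q - 1) * (lam / 4 * volume.real {ξ | lam ≤ |f ξ|}) := by
        rw [Real.rpow_sub_one hl.ne', measureReal_def]; field_simp
    _ ≤ 4 * lam ^ (q - 1) * ((3 / (1 - α) + 1) * r * I) := by gcongr
    _ = _ := by
        rw [hr_def, Real.rpow_neg hl.le]
        have := (Real.rpow_pos_of_pos hl (q - 1)).ne'
        field_simp
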